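/- (Delange-type Tauberian theorem.) Let b : [0,∞) → ℝ be a measurable function which is bounded on finite intervals, such that G(s) := ∫_0^∞ b(t) e^{−st} dt converges absolutely for all complex s with Re(s) > 0, and suppose there exist an integer m ≥ 1 and ε₀ > 0 such that lim_{t→∞} t·b(t)·∫_0^{ε₀} u^{m−1} e^{−tu} du = 1. Let a : [0,∞) → ℝ be nondecreasing and suppose there is α > 0 such that f(s) := ∫_0^∞ a(t) e^{−st} dt converges absolutely for all complex s with Re(s) > α. Suppose there exist a constant c₀ > 0, a polynomial g of degree at most m−2 (identically zero if m = 1), and a function h : ℂ → ℂ which is continuous on {Re(s) ≥ α} and holomorphic on {Re(s) > α}, such that for all s with Re(s) > α, f(s) − c₀·G(s−α) = g(s)/(s−α)^{m−1} + h(s). Then a(t) = (c₀ + o(1))·e^{αt}·b(t) as t → ∞, i.e. a(t)/(e^{αt} b(t)) → c₀. -/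

import Mathlib

open MeasureTheory
open Filter Topology
open scoped FourierTransform Convolution

lemma exists_nonneg_bandlimited_kernel : ∃ (K : ℝ → ℂ) (k : ℝ → ℝ), Continuous K ∧
    HasCompactSupport K ∧ Continuous k ∧ (∀ w, 0 ≤ k w) ∧ (∀ w, 𝓕 K w = k w) ∧
    (∫ w, k w = 1) ∧ ∀ N : ℕ, Integrable fun w ↦ (1 + |w|) ^ N * k w := by
  let φ : ContDiffBump (0 : ℝ) := ⟨1, 2, one_pos, one_lt_two⟩
  have hcs : HasCompactSupport fun x ↦ (φ x : ℂ) :=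
    φ.hasCompactSupport.comp_left (g := fun x : ℝ ↦ (x : ℂ)) (by simp)
  have hcd : ContDiff ℝ (⊤ : ℕ∞) fun x ↦ (φ x : ℂ) :=
    Complex.ofRealCLM.contDiff.comp φ.contDiff
  let f : SchwartzMap ℝ ℂ := hcs.toSchwartzMap hcd
  have hf : ∀ x, f x = φ x := fun x ↦ rfl
  have hfs : HasCompactSupport f := hcs
  let ψ : SchwartzMap ℝ ℂ := 𝓕 f
  have hψ : ∀ w, ψ w = ∫ v : ℝ, Complex.exp (↑(-2 * Real.pi * v * w) * Complex.I) * φ v := by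
    intro w
    change (𝓕 f) w = _
    rw [SchwartzMap.fourier_coe, Real.fourier_real_eq_integral_exp_smul]
    simp [hf]
  have hconj : ∀ w, (starRingEnd ℂ) (ψ w) = ψ w := by
    intro w
    rw [hψ, ← integral_conj, ← integral_neg_eq_self]
    congr 1
    ext v
    simp [← Complex.exp_conj, φ.neg, Complex.conj_ofNat]
  have hsq : ∀ w, ψ w * ψ w = ((‖ψ w‖ ^ 2 : ℝ) : ℂ) := by
    intro w
    have := Complex.mul_conj (ψ w)
    rw [hconj] at this
    rw [this, Complex.normSq_eq_norm_sq]
  have hψdecay : ∀ N : ℕ, Integrable fun w ↦ (1 + |w|) ^ N * ‖ψ w‖ ^ 2 := by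
    intro N
    obtain ⟨C, hC⟩ : ∃ C, ∀ w, ‖ψ w‖ ≤ C :=
      ⟨SchwartzMap.seminorm ℝ 0 0 ψ, fun w ↦ SchwartzMap.norm_le_seminorm ℝ ψ w⟩
    have h1 : Integrable fun w ↦ ((2 : ℝ) ^ (N - 1) * (‖ψ w‖ + ‖w‖ ^ N * ‖ψ w‖)) * C :=
      (((ψ.integrable).norm.add (ψ.integrable_pow_mul volume N)).const_mul _).mul_const _
    refine h1.mono' (Continuous.aestronglyMeasurable (by fun_prop)) (.of_forall fun w ↦ ?_)
    have h2 := add_pow_le zero_le_one (abs_nonneg w) N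
    rw [one_pow] at h2
    rw [Real.norm_of_nonneg (by positivity), pow_two, ← mul_assoc, Real.norm_eq_abs]
    refine mul_le_mul ?_ (hC w) (norm_nonneg _) (by positivity)
    calc _ ≤ _ := mul_le_mul_of_nonneg_right h2 (norm_nonneg _)
      _ = _ := by ring
  have hint : Integrable fun w ↦ ‖ψ w‖ ^ 2 := by simpa using hψdecay 0
  have hpos : 0 < ∫ w, ‖ψ w‖ ^ 2 := by
    have h0 : ψ 0 ≠ 0 := by
      have : ψ 0 = ((∫ v, φ v : ℝ) : ℂ) := by
        rw [hψ, ← integral_complex_ofReal]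
        simp
      rw [this]
      exact_mod_cast φ.integral_pos.ne'
    exact integral_pos_of_integrable_nonneg_nonzero (x := 0) (by fun_prop) hint
      (fun w ↦ by positivity) (by simpa using h0)
  set c := ∫ w, ‖ψ w‖ ^ 2 with hc
  have hconvcont : Continuous (f ⋆[ContinuousLinearMap.mul ℂ ℂ] f) :=
    hfs.continuous_convolution_left _ f.continuous f.continuous.locallyIntegrable
  refine ⟨fun v ↦ (c : ℂ)⁻¹ • (f ⋆[ContinuousLinearMap.mul ℂ ℂ] f) v, fun w ↦ c⁻¹ * ‖ψ w‖ ^ 2,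
    continuous_const.mul hconvcont,
    (hfs.convolution _ hfs).comp_left (g := fun z ↦ (c : ℂ)⁻¹ • z) (by simp),
    by fun_prop, fun w ↦ by positivity, fun w ↦ ?_, ?_, fun N ↦ ?_⟩
  · have h1 : 𝓕 (f ⋆[ContinuousLinearMap.mul ℂ ℂ] f) w = ψ w * ψ w := by
      rw [Real.fourier_mul_convolution_eq f.integrable f.integrable, ← SchwartzMap.fourier_coe]
    have h2 : 𝓕 (fun v ↦ (c : ℂ)⁻¹ • (f ⋆[ContinuousLinearMap.mul ℂ ℂ] f) v) w =
        (c : ℂ)⁻¹ • 𝓕 (f ⋆[ContinuousLinearMap.mul ℂ ℂ] f) w := by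
      simp only [Real.fourier_real_eq_integral_exp_smul]
      rw [← integral_smul]
      congr 1
      ext v
      rw [smul_comm]
    rw [h2, h1, hsq]
    push_cast
    rfl
  · rw [integral_const_mul, inv_mul_cancel₀ hpos.ne']
  · refine ((hψdecay N).const_mul c⁻¹).congr (.of_forall fun w ↦ ?_)
    ring

lemma tendsto_integral_kernel_tail {k : ℝ → ℝ} (hk : Continuous k) (hk0 : ∀ w, 0 ≤ k w) {N : ℕ}
    (hN : Integrable fun w ↦ (1 + |w|) ^ N * k w) {δ : ℝ} (hδ : 0 < δ) :
    Tendsto (fun l : ℝ ↦ ∫ w, {w | δ < |w|}.indicator (fun w ↦ (1 + |w|) ^ N * (l * k (l * w))) w)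
      atTop (𝓝 0) := by
  have h1 : ∀ᶠ l : ℝ in atTop,
      ∫ u, {u | l * δ < |u|}.indicator (fun u ↦ (1 + |u| / l) ^ N * k u) u =
      ∫ w, {w | δ < |w|}.indicator (fun w ↦ (1 + |w|) ^ N * (l * k (l * w))) w := by
    filter_upwards [eventually_ge_atTop 1] with l hl
    have hl0 : 0 < l := by linarith
    have := Measure.integral_comp_mul_left
      (fun u ↦ {u | l * δ < |u|}.indicator (fun u ↦ (1 + |u| / l) ^ N * k u) u) l
    rw [abs_of_pos (inv_pos.2 hl0), smul_eq_mul, eq_inv_mul_iff_mul_eq₀ hl0.ne'] at this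
    rw [← this, ← integral_const_mul]
    congr 1
    ext w
    simp only [Set.indicator_apply, Set.mem_ofPred_eq, abs_mul, abs_of_pos hl0,
      mul_lt_mul_iff_right₀ hl0, mul_div_cancel_left₀ _ hl0.ne']
    split_ifs <;> ring
  refine Tendsto.congr' h1 ?_
  rw [← integral_zero ℝ ℝ]
  refine tendsto_integral_filter_of_dominated_convergence (fun w ↦ (1 + |w|) ^ N * k w) ?_ ?_ hN ?_
  · filter_upwards with l
    refine (Continuous.aestronglyMeasurable (by fun_prop)).indicator ?_
    exact (isOpen_lt continuous_const continuous_abs).measurableSet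
  · filter_upwards [eventually_ge_atTop 1] with l hl
    refine .of_forall fun w ↦ ?_
    refine (norm_indicator_le_norm_self _ _).trans ?_
    have := hk0 w
    rw [Real.norm_of_nonneg (by positivity)]
    have := div_le_self (abs_nonneg w) hl
    gcongr
  · refine .of_forall fun w ↦ tendsto_const_nhds.congr' ?_
    filter_upwards [eventually_ge_atTop (|w| / δ)] with l hl
    rw [Set.indicator_of_notMem]
    simpa using (div_le_iff₀ hδ).1 hl

lemma exists_concentrated_bandlimited_kernel (N : ℕ) {δ : ℝ} (hδ : 0 < δ) :
    ∃ (K : ℝ → ℂ) (k : ℝ → ℝ), Continuous K ∧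
    HasCompactSupport K ∧ Continuous k ∧ (∀ w, 0 ≤ k w) ∧ (∀ w, 𝓕 K w = k w) ∧
    (∫ w, k w = 1) ∧ (Integrable fun w ↦ (1 + |w|) ^ N * k w) ∧
    ∫ w, {w | δ < |w|}.indicator (fun w ↦ (1 + |w|) ^ N * k w) w < δ := by
  obtain ⟨K, k, hK, hKs, hk, hk0, hKk, hk1, hkN⟩ := exists_nonneg_bandlimited_kernel
  obtain ⟨l, hlδ, hl⟩ := (((tendsto_integral_kernel_tail hk hk0 (hkN N) hδ).eventually_lt_const
    hδ).and (eventually_ge_atTop 1)).exists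
  have hl0 : 0 < l := by linarith
  refine ⟨fun v ↦ K (l⁻¹ * v), fun w ↦ l * k (l * w), by fun_prop,
    hKs.comp_homeomorph (Homeomorph.mulLeft₀ l⁻¹ (inv_ne_zero hl0.ne')), by fun_prop,
    fun w ↦ mul_nonneg hl0.le (hk0 _), fun w ↦ ?_, ?_, ?_, hlδ⟩
  · have := Measure.integral_comp_mul_left
      (fun v : ℝ ↦ Complex.exp (↑(-2 * Real.pi * v * (l * w)) * Complex.I) • K v) l⁻¹
    rw [inv_inv, abs_of_pos hl0, ← Real.fourier_real_eq_integral_exp_smul, hKk] at this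
    rw [Real.fourier_real_eq_integral_exp_smul]
    push_cast
    rw [← Complex.real_smul, ← this]
    congr 1
    ext v
    congr 4
    field_simp
    push_cast
    ring
  · rw [integral_const_mul, Measure.integral_comp_mul_left, hk1, abs_of_pos (inv_pos.2 hl0)]
    simp [hl0.ne']
  · have h1 := ((hkN N).comp_mul_left' hl0.ne').const_mul l
    refine h1.mono' (Continuous.aestronglyMeasurable (by fun_prop)) (.of_forall fun w ↦ ?_)
    have := hk0 (l * w)
    rw [Real.norm_of_nonneg (by positivity)]
    have h2 : |w| ≤ |l * w| := by
      rw [abs_mul, abs_of_pos hl0]; exact le_mul_of_one_le_left (abs_nonneg w) hl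
    calc _ = l * ((1 + |w|) ^ N * k (l * w)) := by ring
      _ ≤ _ := by gcongr

lemma integral_mul_exp_mul_fourier {D : ℝ → ℂ} {z : ℂ}
    (hD : IntegrableOn (fun t : ℝ ↦ D t * Complex.exp (-z * t)) (Set.Ioi 0)) {K : ℝ → ℂ}
    (hK : Continuous K) (hKs : HasCompactSupport K) (y : ℝ) :
    ∫ t in Set.Ioi (0 : ℝ), D t * Complex.exp (-z * t) * 𝓕 K (t - y) =
      ∫ v : ℝ, (∫ t in Set.Ioi (0 : ℝ), D t * Complex.exp (-(z + 2 * Real.pi * v * Complex.I) * t)) *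
        (K v * Complex.exp (2 * Real.pi * v * y * Complex.I)) := by
  let F : ℝ → ℂ := (Set.Ioi 0).indicator fun t : ℝ ↦ D t * Complex.exp (-z * t)
  let g : ℝ → ℂ := fun v ↦ K v * Complex.exp (2 * Real.pi * v * y * Complex.I)
  have hF : Integrable F := hD.integrable_indicator measurableSet_Ioi
  have hg : Integrable g :=
    Continuous.integrable_of_hasCompactSupport (by fun_prop) hKs.mul_right
  have key : ∫ v, 𝓕 F v • g v = ∫ t, F t • 𝓕 g t := by
    simpa using! VectorFourier.integral_fourierIntegral_smul_eq_flip (L := innerₗ ℝ)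
      Real.continuous_fourierChar continuous_inner hF hg
  have h1 : ∀ v, 𝓕 F v =
      ∫ t in Set.Ioi (0 : ℝ), D t * Complex.exp (-(z + 2 * Real.pi * v * Complex.I) * t) := by
    intro v
    rw [Real.fourier_real_eq_integral_exp_smul, ← integral_indicator measurableSet_Ioi]
    congr 1
    ext t
    by_cases ht : t ∈ Set.Ioi (0 : ℝ)
    · simp only [F, Set.indicator_of_mem ht, smul_eq_mul]
      rw [mul_left_comm, ← Complex.exp_add]
      congr 2
      push_cast
      ring
    · simp [F, Set.indicator_of_notMem ht]
  have h2 : ∀ t, 𝓕 g t = 𝓕 K (t - y) := by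
    intro t
    simp only [Real.fourier_real_eq_integral_exp_smul, g, smul_eq_mul]
    congr 1
    ext v
    rw [mul_left_comm, ← Complex.exp_add, mul_comm]
    congr 2
    push_cast
    ring
  simp only [h1, h2, smul_eq_mul] at key
  rw [key, ← integral_indicator measurableSet_Ioi]
  congr 1
  ext t
  by_cases ht : t ∈ Set.Ioi (0 : ℝ)
  · simp only [F, Set.indicator_of_mem ht]
  · simp [F, Set.indicator_of_notMem ht]

lemma tendsto_integral_boundary {H : ℂ → ℂ} (hH : ContinuousOn H {z : ℂ | 0 ≤ z.re}) {K : ℝ → ℂ}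
    (hK : Continuous K) (hKs : HasCompactSupport K) (y : ℝ) :
    Tendsto (fun σ : ℝ ↦ ∫ v : ℝ, H (σ + 2 * Real.pi * v * Complex.I) *
        (K v * Complex.exp (2 * Real.pi * v * y * Complex.I))) (𝓝[>] 0)
      (𝓝 (∫ v : ℝ, H (2 * Real.pi * v * Complex.I) *
        (K v * Complex.exp (2 * Real.pi * v * y * Complex.I)))) := by
  have hc : ContinuousOn (fun σ : ℝ ↦ ∫ v : ℝ, H (σ + 2 * Real.pi * v * Complex.I) *
        (K v * Complex.exp (2 * Real.pi * v * y * Complex.I))) (Set.Ici 0) := by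
    refine continuousOn_integral_of_compact_support hKs (ContinuousOn.mul ?_ ?_) ?_
    · refine hH.comp (Continuous.continuousOn (by fun_prop)) ?_
      rintro ⟨σ, v⟩ ⟨hσ, -⟩
      simpa using hσ
    · exact Continuous.continuousOn (by fun_prop)
    · intro σ v _ hv
      simp [image_eq_zero_of_notMem_tsupport hv]
  simpa using (hc 0 Set.self_mem_Ici).tendsto.mono_left (nhdsWithin_mono _ Set.Ioi_subset_Ici_self)

lemma tendsto_integral_boundary_atTop (H K : ℝ → ℂ) :
    Tendsto (fun y : ℝ ↦ ∫ v : ℝ, H v * (K v * Complex.exp (2 * Real.pi * v * y * Complex.I)))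
      atTop (𝓝 0) := by
  have h1 := (Real.zero_at_infty_fourier fun v ↦ H v * K v).comp
    (tendsto_neg_atTop_atBot.mono_right atBot_le_cocompact)
  refine h1.congr fun y ↦ ?_
  simp only [Function.comp_apply, Real.fourier_real_eq_integral_exp_smul, smul_eq_mul]
  congr 1
  ext v
  rw [mul_comm, mul_assoc]
  congr 4
  push_cast
  ring

lemma one_add_le_mul (t y : ℝ) : 1 + t ≤ (1 + |y|) * (1 + |t - y|) := by
  have h1 : t ≤ |y| + |t - y| := by
    have := le_abs_self y
    have := le_abs_self (t - y)
    linarith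
  have := mul_nonneg (abs_nonneg y) (abs_nonneg (t - y))
  linarith

lemma tendsto_add_div_self_pow (w : ℝ) (N : ℕ) :
    Tendsto (fun y : ℝ ↦ ((w + y) / y) ^ N) atTop (𝓝 1) := by
  have : Tendsto (fun y : ℝ ↦ (w / y + 1) ^ N) atTop (𝓝 ((0 + 1) ^ N)) :=
    ((tendsto_const_nhds.div_atTop tendsto_id).add_const 1).pow N
  rw [zero_add, one_pow] at this
  refine this.congr' ?_
  filter_upwards [eventually_gt_atTop 0] with y hy
  rw [add_div, div_self hy.ne']

section Smoothing

variable {N : ℕ} {k : ℝ → ℝ}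

lemma integrableOn_pow_mul_comp_sub (hk : Continuous k) (hk0 : ∀ w, 0 ≤ k w)
    (hkN : Integrable fun w ↦ (1 + |w|) ^ N * k w) (y : ℝ) :
    IntegrableOn (fun t ↦ (1 + t) ^ N * k (t - y)) (Set.Ioi 0) := by
  have h1 := ((hkN.comp_sub_right y).const_mul ((1 + |y|) ^ N)).integrableOn (s := Set.Ioi 0)
  refine h1.mono' (Continuous.aestronglyMeasurable (by fun_prop)) ?_
  filter_upwards [ae_restrict_mem measurableSet_Ioi] with t ht
  have ht' : 0 < t := ht
  have := hk0 (t - y)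
  rw [Real.norm_of_nonneg (by positivity), ← mul_assoc, ← mul_pow]
  gcongr
  exact one_add_le_mul t y

lemma tendsto_smoothed_div_pow {B : ℝ → ℂ}
    (hBm : AEStronglyMeasurable B (volume.restrict (Set.Ioi 0)))
    {C : ℝ} (hBC : ∀ t > 0, ‖B t‖ ≤ C * (1 + t) ^ N) {L : ℂ}
    (hBL : Tendsto (fun t : ℝ ↦ B t / (t : ℂ) ^ N) atTop (𝓝 L)) (hk : Continuous k)
    (hk0 : ∀ w, 0 ≤ k w) (hk1 : ∫ w, k w = 1) (hkN : Integrable fun w ↦ (1 + |w|) ^ N * k w) :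
    Tendsto (fun y : ℝ ↦ (∫ t in Set.Ioi (0 : ℝ), B t * k (t - y)) / (y : ℂ) ^ N)
      atTop (𝓝 L) := by
  have hC : 0 ≤ C := nonneg_of_mul_nonneg_left ((norm_nonneg _).trans (hBC 1 one_pos)) (by positivity)
  let G : ℝ → ℝ → ℂ := fun y w ↦ (Set.Ioi 0).indicator B (w + y) * k w / (y : ℂ) ^ N
  have hG : ∀ y, (∫ t in Set.Ioi (0 : ℝ), B t * k (t - y)) / (y : ℂ) ^ N = ∫ w, G y w := by
    intro y
    rw [← integral_indicator measurableSet_Ioi, ← integral_add_right_eq_self _ y,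
      ← integral_div]
    congr 1
    ext w
    by_cases h : 0 < w + y <;> simp [G, Set.indicator, h]
  simp only [hG]
  have hL : ∫ w, L * (k w : ℂ) = L := by
    rw [integral_const_mul, integral_complex_ofReal, hk1]; simp
  rw [← hL]
  refine tendsto_integral_filter_of_dominated_convergence
    (fun w ↦ (C * 2 ^ N) * ((1 + |w|) ^ N * k w)) ?_ ?_ (hkN.const_mul _) ?_
  · refine .of_forall fun y ↦ ?_
    have h1 : AEStronglyMeasurable ((Set.Ioi 0).indicator B) :=
      (aestronglyMeasurable_indicator_iff measurableSet_Ioi).2 hBm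
    have h2 := h1.comp_measurePreserving (measurePreserving_add_right volume y)
    have h3 : AEStronglyMeasurable fun w ↦ (k w : ℂ) :=
      Continuous.aestronglyMeasurable (by fun_prop)
    have := (h2.mul h3).mul (aestronglyMeasurable_const (b := ((y : ℂ) ^ N)⁻¹))
    exact this
  · filter_upwards [eventually_ge_atTop 1] with y hy
    refine .of_forall fun w ↦ ?_
    have hy0 : 0 < y := by linarith
    have := hk0 w
    by_cases h : w + y ∈ Set.Ioi (0 : ℝ)
    · have h' : 0 < w + y := h
      simp only [G, Set.indicator_of_mem h, norm_div, norm_mul, norm_pow, Complex.norm_real,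
        Real.norm_of_nonneg this, Real.norm_of_nonneg hy0.le]
      rw [div_le_iff₀ (by positivity)]
      calc _ ≤ C * (1 + (w + y)) ^ N * k w := by gcongr; exact hBC _ h'
        _ ≤ C * (2 * y * (1 + |w|)) ^ N * k w := by
          gcongr
          have := one_add_le_mul (w + y) y
          rw [add_sub_cancel_right, abs_of_pos hy0] at this
          refine this.trans ?_
          gcongr
          linarith
        _ = _ := by rw [mul_pow, mul_pow]; ring
    · simp only [G, Set.indicator_of_notMem h, zero_mul, zero_div, norm_zero]
      positivity
  · refine .of_forall fun w ↦ ?_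
    have h1 : Tendsto (fun y : ℝ ↦ w + y) atTop atTop := tendsto_atTop_add_const_left _ _ tendsto_id
    have h2 : Tendsto (fun y : ℝ ↦ ((((w + y) / y) ^ N : ℝ) : ℂ)) atTop (𝓝 1) := by
      have := (Complex.continuous_ofReal.tendsto 1).comp (tendsto_add_div_self_pow w N)
      rwa [Complex.ofReal_one] at this
    have h3 := (((hBL.comp h1).mul h2).mul_const (k w : ℂ))
    rw [mul_one] at h3
    refine h3.congr' ?_
    filter_upwards [eventually_gt_atTop 0, eventually_gt_atTop (-w)] with y hy hyw
    have h' : 0 < w + y := by linarith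
    have h'' : (w : ℂ) + y ≠ 0 := by exact_mod_cast h'.ne'
    have hy' : (y : ℂ) ≠ 0 := by exact_mod_cast hy.ne'
    simp only [G, Set.indicator_of_mem (show w + y ∈ Set.Ioi 0 from h'), Function.comp_apply]
    push_cast
    rw [div_pow]
    field_simp

end Smoothing

lemma integrableOn_mul_kernel_of_norm_le {N : ℕ} {k : ℝ → ℝ} {B : ℝ → ℂ}
    (hBm : AEStronglyMeasurable B (volume.restrict (Set.Ioi 0)))
    {C : ℝ} (hBC : ∀ t > 0, ‖B t‖ ≤ C * (1 + t) ^ N) (hk : Continuous k) (hk0 : ∀ w, 0 ≤ k w)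
    (hkN : Integrable fun w ↦ (1 + |w|) ^ N * k w) (y : ℝ) :
    IntegrableOn (fun t ↦ B t * k (t - y)) (Set.Ioi 0) := by
  refine ((integrableOn_pow_mul_comp_sub hk hk0 hkN y).const_mul C).mono'
    (hBm.mul (Continuous.aestronglyMeasurable (by fun_prop))) ?_
  filter_upwards [ae_restrict_mem measurableSet_Ioi] with t ht
  rw [norm_mul, Complex.norm_real, Real.norm_of_nonneg (hk0 _), ← mul_assoc]
  exact mul_le_mul_of_nonneg_right (hBC t ht) (hk0 _)

lemma tendsto_integral_mul_exp_neg_mul {F : ℝ → ℂ} (hF : IntegrableOn F (Set.Ioi 0))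
    {σ : ℕ → ℝ} (hσ0 : ∀ n, 0 < σ n) (hσ : Tendsto σ atTop (𝓝 0)) :
    Tendsto (fun n ↦ ∫ t in Set.Ioi (0 : ℝ), F t * Complex.exp (-σ n * t)) atTop
      (𝓝 (∫ t in Set.Ioi (0 : ℝ), F t)) := by
  refine tendsto_integral_of_dominated_convergence (fun t ↦ ‖F t‖) (fun n ↦ ?_) hF.norm
    (fun n ↦ ?_) ?_
  · exact hF.aestronglyMeasurable.mul (Continuous.aestronglyMeasurable (by fun_prop))
  · filter_upwards [ae_restrict_mem measurableSet_Ioi] with t ht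
    rw [norm_mul, Complex.norm_exp]
    refine mul_le_of_le_one_right (norm_nonneg _) (Real.exp_le_one_iff.2 ?_)
    have := mul_pos (hσ0 n) (show 0 < t from ht)
    simpa using this.le
  · refine .of_forall fun t ↦ ?_
    have : Tendsto (fun n ↦ F t * Complex.exp (-(σ n : ℂ) * t)) atTop
        (𝓝 (F t * Complex.exp (-((0 : ℝ) : ℂ) * t))) := by
      have h := (Complex.continuous_ofReal.tendsto 0).comp hσ
      exact ((Complex.continuous_exp.tendsto _).comp (h.neg.mul_const _)).const_mul _
    simpa using this

/-- If the Laplace transform of `A - B` extends continuously to the closed right half plane, then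
the averages of `A ≥ 0` against a nonnegative band-limited kernel have the asymptotics dictated
by `B`. -/
theorem tendsto_smoothed_of_laplace_boundary {A : ℝ → ℝ} {B : ℝ → ℂ} {N : ℕ} {C L : ℝ} {H : ℂ → ℂ}
    (hA : ∀ t > 0, 0 ≤ A t) (hBm : AEStronglyMeasurable B (volume.restrict (Set.Ioi 0)))
    (hBC : ∀ t > 0, ‖B t‖ ≤ C * (1 + t) ^ N)
    (hBL : Tendsto (fun t : ℝ ↦ B t / (t : ℂ) ^ N) atTop (𝓝 L))
    (hD : ∀ z : ℂ, 0 < z.re →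
      IntegrableOn (fun t : ℝ ↦ (A t - B t) * Complex.exp (-z * t)) (Set.Ioi 0))
    (hDH : ∀ z : ℂ, 0 < z.re →
      ∫ t in Set.Ioi (0 : ℝ), (A t - B t) * Complex.exp (-z * t) = H z)
    (hH : ContinuousOn H {z : ℂ | 0 ≤ z.re})
    {K : ℝ → ℂ} {k : ℝ → ℝ} (hK : Continuous K) (hKs : HasCompactSupport K) (hk : Continuous k)
    (hk0 : ∀ w, 0 ≤ k w) (hKk : ∀ w, 𝓕 K w = k w) (hk1 : ∫ w, k w = 1)
    (hkN : Integrable fun w ↦ (1 + |w|) ^ N * k w) :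
    (∀ y, IntegrableOn (fun t ↦ A t * k (t - y)) (Set.Ioi 0)) ∧
      Tendsto (fun y : ℝ ↦ (∫ t in Set.Ioi (0 : ℝ), A t * k (t - y)) / y ^ N) atTop (𝓝 L) := by
  let R : ℝ → ℂ := fun y ↦ ∫ v : ℝ, H (2 * Real.pi * v * Complex.I) *
        (K v * Complex.exp (2 * Real.pi * v * y * Complex.I))
  let σ : ℕ → ℝ := fun n ↦ 1 / ((n : ℝ) + 1)
  have hσ0 : ∀ n, 0 < σ n := fun n ↦ by positivity
  have hσ : Tendsto σ atTop (𝓝 0) := tendsto_one_div_add_atTop_nhds_zero_nat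
  obtain ⟨M, hM⟩ : ∃ M, ∀ w, ‖k w‖ ≤ M := by
    refine ⟨∫ v, ‖K v‖, fun w ↦ ?_⟩
    rw [← Complex.norm_real, ← hKk]
    exact VectorFourier.norm_fourierIntegral_le_integral_norm _ _ _ _ _
  have hBk := integrableOn_mul_kernel_of_norm_le hBm hBC hk hk0 hkN
  have hmain : ∀ y, IntegrableOn (fun t ↦ A t * k (t - y)) (Set.Ioi 0) ∧
      ((∫ t in Set.Ioi (0 : ℝ), A t * k (t - y) : ℝ) : ℂ) =
        (∫ t in Set.Ioi (0 : ℝ), B t * k (t - y)) + R y := by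
    intro y
    have hDk : ∀ n, IntegrableOn (fun t : ℝ ↦ (A t - B t) * Complex.exp (-σ n * t) * k (t - y))
        (Set.Ioi 0) := by
      intro n
      refine (hD (σ n) (by simpa using hσ0 n)).mul_bdd (c := M)
        (Continuous.aestronglyMeasurable (by fun_prop)) (.of_forall fun t ↦ ?_)
      simpa using hM (t - y)
    have hDlim : Tendsto (fun n ↦ ∫ t in Set.Ioi (0 : ℝ),
        (A t - B t) * Complex.exp (-σ n * t) * k (t - y)) atTop (𝓝 (R y)) := by
      refine ((tendsto_integral_boundary hH hK hKs y).comp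
        (tendsto_nhdsWithin_iff.2 ⟨hσ, .of_forall hσ0⟩)).congr fun n ↦ ?_
      simp only [Function.comp_apply, ← hKk]
      rw [integral_mul_exp_mul_fourier (hD (σ n) (by simpa using hσ0 n)) hK hKs]
      congr 1
      ext v
      rw [hDH]
      simpa using hσ0 n
    have hBσ : ∀ n, IntegrableOn (fun t : ℝ ↦ B t * k (t - y) * Complex.exp (-σ n * t))
        (Set.Ioi 0) := by
      intro n
      refine (hBk y).mul_bdd (c := 1)
        (Continuous.aestronglyMeasurable (by fun_prop)) ?_
      filter_upwards [ae_restrict_mem measurableSet_Ioi] with t ht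
      rw [Complex.norm_exp]
      refine Real.exp_le_one_iff.2 ?_
      have := mul_pos (hσ0 n) (show 0 < t from ht)
      simpa using this.le
    have hBlim := tendsto_integral_mul_exp_neg_mul (hBk y) hσ0 hσ
    have hsum : ∀ n, (fun t : ℝ ↦ (((A t * k (t - y)) * Real.exp (-σ n * t) : ℝ) : ℂ)) =
        fun t ↦ B t * k (t - y) * Complex.exp (-σ n * t) +
          (A t - B t) * Complex.exp (-σ n * t) * k (t - y) := by
      intro n
      ext t
      push_cast
      ring
    have hAσ : ∀ n, IntegrableOn (fun t : ℝ ↦ (A t * k (t - y)) * Real.exp (-σ n * t))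
        (Set.Ioi 0) := by
      intro n
      have h1 := (hBσ n).add (hDk n)
      have h2 : IntegrableOn (fun t : ℝ ↦ (((A t * k (t - y)) * Real.exp (-σ n * t) : ℝ) : ℂ))
        (Set.Ioi 0) := by
        rw [hsum n]; exact h1
      exact h2.re
    have hAlim : Tendsto (fun n ↦ ((∫ t in Set.Ioi (0 : ℝ),
        (A t * k (t - y)) * Real.exp (-σ n * t) : ℝ) : ℂ)) atTop
        (𝓝 ((∫ t in Set.Ioi (0 : ℝ), B t * k (t - y)) + R y)) := by
      refine (hBlim.add hDlim).congr fun n ↦ ?_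
      rw [← integral_complex_ofReal, hsum n, integral_add (hBσ n) (hDk n)]
    have hAlim' : Tendsto (fun n ↦ ∫ t in Set.Ioi (0 : ℝ),
        (A t * k (t - y)) * Real.exp (-σ n * t)) atTop
        (𝓝 ((∫ t in Set.Ioi (0 : ℝ), B t * k (t - y)) + R y).re) :=
      (Complex.continuous_re.tendsto _).comp hAlim
    have hint : IntegrableOn (fun t ↦ A t * k (t - y)) (Set.Ioi 0) := by
      refine integrable_of_tendsto (G := fun n t ↦ (A t * k (t - y)) * Real.exp (-σ n * t))
        (.of_forall fun t ↦ ?_) (fun n ↦ (hAσ n).aestronglyMeasurable) ?_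
      · have h := (Real.continuous_exp.tendsto _).comp (hσ.neg.mul_const t)
        simpa using h.const_mul (A t * k (t - y))
      · have h := (ENNReal.continuous_ofReal.tendsto _).comp hAlim'
        have h' : ∀ n, ∫⁻ t in Set.Ioi (0 : ℝ), ‖(A t * k (t - y)) * Real.exp (-σ n * t)‖ₑ =
            ENNReal.ofReal (∫ t in Set.Ioi (0 : ℝ), (A t * k (t - y)) * Real.exp (-σ n * t)) := by
          intro n
          rw [ofReal_integral_eq_lintegral_ofReal (hAσ n)]
          · refine setLIntegral_congr_fun measurableSet_Ioi fun t ht ↦ ?_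
            have := hk0 (t - y)
            have := hA t ht
            exact Real.enorm_of_nonneg (by positivity)
          · filter_upwards [ae_restrict_mem measurableSet_Ioi] with t ht
            have := hk0 (t - y)
            have := hA t ht
            simp only [Pi.zero_apply]
            positivity
        simp only [h']
        exact ne_of_eq_of_ne (Tendsto.liminf_eq h) ENNReal.ofReal_ne_top
    refine ⟨hint, ?_⟩
    have h1 := tendsto_integral_mul_exp_neg_mul (F := fun t ↦ ((A t * k (t - y) : ℝ) : ℂ))
      hint.ofReal hσ0 hσ
    rw [integral_complex_ofReal] at h1
    refine tendsto_nhds_unique (h1.congr fun n ↦ ?_) hAlim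
    rw [← integral_complex_ofReal]
    congr 1
    ext t
    push_cast
    rfl
  refine ⟨fun y ↦ (hmain y).1, ?_⟩
  have hR : Tendsto (fun y : ℝ ↦ R y / (y : ℂ) ^ N) atTop (𝓝 0) := by
    have h0 := (tendsto_integral_boundary_atTop
      (fun v ↦ H (2 * Real.pi * v * Complex.I)) K).norm
    rw [norm_zero] at h0
    refine squeeze_zero_norm' ?_ h0
    filter_upwards [eventually_ge_atTop 1] with y hy
    rw [norm_div, norm_pow, Complex.norm_real]
    refine div_le_self (norm_nonneg _) (one_le_pow₀ (hy.trans (le_abs_self y)))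
  have h1 := (tendsto_smoothed_div_pow hBm hBC hBL hk hk0 hk1 hkN).add hR
  have h2 := (Complex.continuous_re.tendsto _).comp h1
  rw [add_zero, Complex.ofReal_re] at h2
  refine h2.congr fun y ↦ ?_
  simp only [Function.comp_apply]
  rw [← add_div, ← (hmain y).2, ← Complex.ofReal_pow, ← Complex.ofReal_div, Complex.ofReal_re]

lemma tendsto_comp_add_div_pow {S : ℝ → ℝ} {N : ℕ} {L : ℝ}
    (hS : Tendsto (fun y ↦ S y / y ^ N) atTop (𝓝 L)) (w : ℝ) :
    Tendsto (fun y ↦ S (w + y) / y ^ N) atTop (𝓝 L) := by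
  have h1 := (hS.comp (tendsto_atTop_add_const_left atTop w tendsto_id)).mul
    (tendsto_add_div_self_pow w N)
  rw [mul_one] at h1
  refine h1.congr' ?_
  filter_upwards [eventually_gt_atTop 0, eventually_gt_atTop (-w)] with y hy hyw
  have h' : w + y ≠ 0 := by linarith
  simp only [Function.comp_apply, id_eq]
  rw [div_pow]
  field_simp

section Unsmoothing

variable {A k : ℝ → ℝ} {α δ : ℝ} {N : ℕ}

lemma mul_le_smoothed (hα : 0 < α) (hpos : ∀ t, 0 ≤ t → 0 ≤ A t)
    (hmono : ∀ s t, 0 ≤ s → s ≤ t → A s ≤ A t * Real.exp (α * (t - s)))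
    (hk0 : ∀ w, 0 ≤ k w) (hk1 : ∫ w, k w = 1)
    (hkN : Integrable fun w ↦ (1 + |w|) ^ N * k w)
    (htail : ∫ w, {w | δ < |w|}.indicator (fun w ↦ (1 + |w|) ^ N * k w) w < δ)
    (hint : ∀ y, IntegrableOn (fun t ↦ A t * k (t - y)) (Set.Ioi 0)) {y : ℝ} (hy : 0 < y) :
    A y * Real.exp (-(2 * α * δ)) * (1 - δ) ≤
      ∫ t in Set.Ioi (0 : ℝ), A t * k (t - (δ + y)) := by
  have hm : MeasurableSet {w : ℝ | δ < |w|} :=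
    (isOpen_lt continuous_const continuous_abs).measurableSet
  have hki : Integrable k := integrable_of_integral_eq_one hk1
  have hAy := hpos y hy.le
  have hmass : 1 - δ ≤ ∫ w, {w : ℝ | δ < |w|}ᶜ.indicator k w := by
    have h1 : ∫ w, {w : ℝ | δ < |w|}.indicator k w ≤
        ∫ w, {w | δ < |w|}.indicator (fun w ↦ (1 + |w|) ^ N * k w) w := by
      refine integral_mono (hki.indicator hm) (hkN.indicator hm) fun w ↦ ?_
      refine Set.indicator_le_indicator ?_
      refine le_mul_of_one_le_left (hk0 w) (one_le_pow₀ ?_)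
      linarith [abs_nonneg w]
    have h2 := integral_add_compl hm hki
    rw [← integral_indicator hm, ← integral_indicator hm.compl, hk1] at h2
    linarith
  rw [← integral_indicator measurableSet_Ioi]
  calc _ ≤ A y * Real.exp (-(2 * α * δ)) * ∫ w, {w : ℝ | δ < |w|}ᶜ.indicator k w := by gcongr
    _ = ∫ t, A y * Real.exp (-(2 * α * δ)) * {w : ℝ | δ < |w|}ᶜ.indicator k (t - (δ + y)) := by
      rw [integral_const_mul, integral_sub_right_eq_self]
    _ ≤ _ := by
      refine integral_mono (((hki.indicator hm.compl).comp_sub_right _).const_mul _)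
        ((hint _).integrable_indicator measurableSet_Ioi) fun t ↦ ?_
      have hnn : 0 ≤ (Set.Ioi 0).indicator (fun t ↦ A t * k (t - (δ + y))) t :=
        Set.indicator_nonneg (fun t ht ↦ mul_nonneg (hpos t (le_of_lt ht)) (hk0 _)) t
      by_cases h : δ < |t - (δ + y)|
      · simpa [Set.indicator, h] using hnn
      · obtain ⟨h1, h2⟩ := abs_le.1 (not_lt.1 h)
        have hyt : y ≤ t := by linarith
        have ht : 0 < t := by linarith
        have h3 : A y * Real.exp (-(2 * α * δ)) ≤ A t := by
          calc _ ≤ (A t * Real.exp (α * (t - y))) * Real.exp (-(2 * α * δ)) := by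
                gcongr; exact hmono y t hy.le hyt
            _ = A t * Real.exp (α * (t - y) - 2 * α * δ) := by
                rw [mul_assoc, ← Real.exp_add, ← sub_eq_add_neg]
            _ ≤ A t * 1 := by
                have := hpos t ht.le
                gcongr
                rw [Real.exp_le_one_iff]
                nlinarith
            _ = A t := mul_one _
        simpa [Set.indicator, h, ht] using mul_le_mul_of_nonneg_right h3 (hk0 (t - (δ + y)))

lemma smoothed_le (hα : 0 < α) (hδ : 0 < δ) (hpos : ∀ t, 0 ≤ t → 0 ≤ A t)
    (hmono : ∀ s t, 0 ≤ s → s ≤ t → A s ≤ A t * Real.exp (α * (t - s)))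
    (hk0 : ∀ w, 0 ≤ k w) (hk1 : ∫ w, k w = 1)
    (hkN : Integrable fun w ↦ (1 + |w|) ^ N * k w)
    (htail : ∫ w, {w | δ < |w|}.indicator (fun w ↦ (1 + |w|) ^ N * k w) w < δ)
    (hint : ∀ y, IntegrableOn (fun t ↦ A t * k (t - y)) (Set.Ioi 0))
    {C : ℝ} (hC0 : 0 ≤ C) (hC : ∀ t, 0 ≤ t → A t ≤ C * (1 + t) ^ N) {y : ℝ} (hy : δ ≤ y) :
    ∫ t in Set.Ioi (0 : ℝ), A t * k (t - (-δ + y)) ≤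
      A y * Real.exp (2 * α * δ) + C * (1 + y) ^ N * δ := by
  have hm : MeasurableSet {w : ℝ | δ < |w|} :=
    (isOpen_lt continuous_const continuous_abs).measurableSet
  have hki : Integrable k := integrable_of_integral_eq_one hk1
  have hy0 : 0 < y := by linarith
  have hAy := hpos y hy0.le
  let T : ℝ → ℝ := {w | δ < |w|}.indicator (fun w ↦ (1 + |w|) ^ N * k w)
  have hT0 : ∀ w, 0 ≤ T w :=
    fun w ↦ Set.indicator_nonneg (fun w _ ↦ mul_nonneg (by positivity) (hk0 w)) w
  have hTi : Integrable T := hkN.indicator hm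
  rw [← integral_indicator measurableSet_Ioi]
  calc _ ≤ ∫ t, (A y * Real.exp (2 * α * δ) * k (t - (-δ + y)) +
            C * (1 + y) ^ N * T (t - (-δ + y))) := by
        refine integral_mono ((hint _).integrable_indicator measurableSet_Ioi)
          (((hki.comp_sub_right _).const_mul _).add ((hTi.comp_sub_right _).const_mul _))
          fun t ↦ ?_
        have hk' := hk0 (t - (-δ + y))
        have hT' := hT0 (t - (-δ + y))
        by_cases ht : 0 < t
        · simp only [Set.indicator_of_mem (show t ∈ Set.Ioi 0 from ht)]
          by_cases h : δ < |t - (-δ + y)|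
          · refine le_add_of_nonneg_of_le (by positivity) ?_
            simp only [T, Set.indicator_of_mem (show _ ∈ {w : ℝ | δ < |w|} from h)]
            rw [← mul_assoc]
            gcongr
            refine (hC t ht.le).trans ?_
            rw [mul_assoc, ← mul_pow]
            gcongr
            refine (one_add_le_mul t (-δ + y)).trans ?_
            gcongr
            rw [abs_of_nonneg (by linarith)]
            linarith
          · obtain ⟨h1, h2⟩ := abs_le.1 (not_lt.1 h)
            refine le_add_of_le_of_nonneg ?_ (by positivity)
            gcongr
            refine (hmono t y ht.le (by linarith)).trans ?_
            gcongr A y * Real.exp ?_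
            nlinarith
        · rw [Set.indicator_of_notMem (by simpa using ht)]
          positivity
    _ = A y * Real.exp (2 * α * δ) * 1 + C * (1 + y) ^ N * ∫ w, T w := by
        rw [integral_add ((hki.comp_sub_right _).const_mul _) ((hTi.comp_sub_right _).const_mul _),
          integral_const_mul, integral_const_mul, integral_sub_right_eq_self k,
          integral_sub_right_eq_self T, hk1]
    _ ≤ _ := by
        rw [mul_one]
        gcongr

/-- Recovery of the asymptotics of a slowly decreasing function from the asymptotics of its
averages against concentrated kernels. -/
theorem tendsto_div_pow_of_smoothed {L : ℝ} (hα : 0 < α) (hpos : ∀ t, 0 ≤ t → 0 ≤ A t)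
    (hmono : ∀ s t, 0 ≤ s → s ≤ t → A s ≤ A t * Real.exp (α * (t - s)))
    (hker : ∀ δ : ℝ, 0 < δ → ∃ k : ℝ → ℝ, (∀ w, 0 ≤ k w) ∧ (∫ w, k w = 1) ∧
      (Integrable fun w ↦ (1 + |w|) ^ N * k w) ∧
      (∫ w, {w | δ < |w|}.indicator (fun w ↦ (1 + |w|) ^ N * k w) w < δ) ∧
      (∀ y, IntegrableOn (fun t ↦ A t * k (t - y)) (Set.Ioi 0)) ∧
      Tendsto (fun y : ℝ ↦ (∫ t in Set.Ioi (0 : ℝ), A t * k (t - y)) / y ^ N) atTop (𝓝 L)) :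
    Tendsto (fun y ↦ A y / y ^ N) atTop (𝓝 L) := by
  have hupper : ∀ c, L < c → ∀ᶠ y in atTop, A y / y ^ N < c := by
    intro c hc
    have hlim : Tendsto (fun δ : ℝ ↦ L * (Real.exp (2 * α * δ) / (1 - δ))) (𝓝[>] 0) (𝓝 L) := by
      have : ContinuousAt (fun δ : ℝ ↦ L * (Real.exp (2 * α * δ) / (1 - δ))) 0 := by
        refine ContinuousAt.mul continuousAt_const (ContinuousAt.div ?_ ?_ (by norm_num)) <;> fun_prop
      simpa using this.tendsto.mono_left nhdsWithin_le_nhds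
    obtain ⟨δ, hδc, hδ0, hδ1⟩ := ((hlim.eventually_lt_const hc).and
      (Ioo_mem_nhdsGT one_pos)).exists
    obtain ⟨k, hk0, hk1, hkN, htail, hint, hS⟩ := hker δ hδ0
    have h1 := (tendsto_comp_add_div_pow hS δ).mul_const (Real.exp (2 * α * δ) / (1 - δ))
    filter_upwards [h1.eventually_lt_const hδc, eventually_gt_atTop 0] with y hy hy0
    refine lt_of_le_of_lt ?_ hy
    have h2 := mul_le_smoothed hα hpos hmono hk0 hk1 hkN htail hint hy0
    have h3 : A y ≤ (∫ t in Set.Ioi (0 : ℝ), A t * k (t - (δ + y))) *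
        (Real.exp (2 * α * δ) / (1 - δ)) := by
      rw [← mul_div_assoc, le_div_iff₀ (by linarith)]
      calc _ = A y * Real.exp (-(2 * α * δ)) * (1 - δ) * Real.exp (2 * α * δ) := by
            rw [Real.exp_neg]; field_simp
        _ ≤ _ := by gcongr
    rw [div_mul_eq_mul_div]
    gcongr
  obtain ⟨C, hC0, hC⟩ : ∃ C, 0 ≤ C ∧ ∀ t, 0 ≤ t → A t ≤ C * (1 + t) ^ N := by
    obtain ⟨T, hT⟩ := eventually_atTop.1
      ((hupper (L + 1) (by linarith)).and (eventually_gt_atTop 0))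
    have hT0 : 0 < T := (hT T le_rfl).2
    have hAT := hpos T hT0.le
    refine ⟨|L + 1| + A T * Real.exp (α * T), by positivity, fun t ht ↦ ?_⟩
    rw [add_mul]
    rcases le_total t T with h | h
    · refine le_add_of_nonneg_of_le (by positivity) ?_
      refine (hmono t T ht h).trans ?_
      calc _ ≤ A T * Real.exp (α * T) * 1 := by rw [mul_one]; gcongr; linarith
        _ ≤ _ := by gcongr; exact one_le_pow₀ (by linarith)
    · refine le_add_of_le_of_nonneg ?_ (by positivity)
      have ht0 := (hT t h).2
      have h1 := ((div_lt_iff₀ (by positivity)).1 (hT t h).1).le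
      refine h1.trans ?_
      gcongr
      · exact le_abs_self _
      · linarith
  refine tendsto_order.2 ⟨fun c hc ↦ ?_, fun c hc ↦ hupper c hc⟩
  have hlim : Tendsto (fun δ : ℝ ↦ (L - C * 2 ^ N * δ) * Real.exp (-(2 * α * δ))) (𝓝[>] 0) (𝓝 L) := by
    have : Continuous (fun δ : ℝ ↦ (L - C * 2 ^ N * δ) * Real.exp (-(2 * α * δ))) := by fun_prop
    simpa using (this.tendsto 0).mono_left nhdsWithin_le_nhds
  obtain ⟨δ, hδc, hδ0⟩ := ((hlim.eventually_const_lt hc).and self_mem_nhdsWithin).exists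
  have hδ0 : 0 < δ := hδ0
  obtain ⟨k, hk0, hk1, hkN, htail, hint, hS⟩ := hker δ hδ0
  have h1 := ((tendsto_comp_add_div_pow hS (-δ)).sub_const (C * 2 ^ N * δ)).mul_const
    (Real.exp (-(2 * α * δ)))
  filter_upwards [h1.eventually_const_lt hδc, eventually_ge_atTop 1, eventually_ge_atTop δ]
    with y hy hy1 hyδ
  refine lt_of_lt_of_le hy ?_
  have h2 := smoothed_le hα hδ0 hpos hmono hk0 hk1 hkN htail hint hC0 hC hyδ
  have hy0 : 0 < y := by linarith
  have h3 : C * (1 + y) ^ N * δ ≤ C * 2 ^ N * δ * y ^ N := by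
    calc _ ≤ C * (2 * y) ^ N * δ := by gcongr; linarith
      _ = _ := by rw [mul_pow]; ring
  rw [Real.exp_neg, ← div_eq_mul_inv, div_le_iff₀ (Real.exp_pos _), sub_le_iff_le_add,
    div_le_iff₀ (by positivity), add_mul]
  calc _ ≤ _ := h2
    _ ≤ A y * Real.exp (2 * α * δ) + C * 2 ^ N * δ * y ^ N := by gcongr
    _ = _ := by field_simp

end Unsmoothing

lemma integrableOn_pow_mul_cexp_neg_mul (n : ℕ) {z : ℂ} (hz : 0 < z.re) :
    IntegrableOn (fun t : ℝ ↦ (t : ℂ) ^ n * Complex.exp (-z * t)) (Set.Ioi 0) := by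
  have h := integrableOn_rpow_mul_exp_neg_mul_rpow (s := n) (p := 1) (b := z.re)
    (by linarith [n.cast_nonneg (α := ℝ)]) one_pos hz
  refine h.mono' (Continuous.aestronglyMeasurable (by fun_prop)) ?_
  filter_upwards [ae_restrict_mem measurableSet_Ioi] with t ht
  have ht : 0 < t := ht
  simp [Complex.norm_exp, abs_of_pos ht]

lemma integral_pow_mul_cexp_neg_mul (n : ℕ) {z : ℂ} (hz : 0 < z.re) :
    ∫ t in Set.Ioi (0 : ℝ), (t : ℂ) ^ n * Complex.exp (-z * t) = n.factorial / z ^ (n + 1) := by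
  have hz0 : z ≠ 0 := by rintro rfl; simp at hz
  have hlim : ∀ n : ℕ, Tendsto (fun t : ℝ ↦ (t : ℂ) ^ n * Complex.exp (-z * t)) atTop (𝓝 0) := by
    intro n
    rw [tendsto_zero_iff_norm_tendsto_zero]
    have h := (isLittleO_pow_exp_pos_mul_atTop n hz).tendsto_div_nhds_zero
    refine h.congr' ?_
    filter_upwards [eventually_ge_atTop 0] with t ht
    simp [Complex.norm_exp, abs_of_nonneg ht, Real.exp_neg, div_eq_mul_inv]
  have hexp : ∀ t : ℝ, HasDerivAt (fun t : ℝ ↦ Complex.exp (-z * t)) (-z * Complex.exp (-z * t)) t := by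
    intro t
    have h := ((hasDerivAt_id (t : ℂ)).const_mul (-z)).cexp.comp_ofReal
    simpa [mul_comm] using h
  induction n with
  | zero =>
    have h := integral_Ioi_of_hasDerivAt_of_tendsto' (a := 0) (fun t _ ↦ hexp t)
      (by simpa [IntegrableOn] using (integrableOn_pow_mul_cexp_neg_mul 0 hz).const_mul (-z))
      (by simpa using hlim 0)
    rw [integral_const_mul] at h
    simp only [pow_zero, one_mul, Nat.factorial_zero, Nat.cast_one, zero_add, pow_one]
    rw [eq_div_iff hz0]
    simpa [mul_comm] using h
  | succ n ih =>
    have hd : ∀ t : ℝ, HasDerivAt (fun t : ℝ ↦ (t : ℂ) ^ (n + 1) * Complex.exp (-z * t))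
        ((n + 1) * ((t : ℂ) ^ n * Complex.exp (-z * t)) +
          (-z) * ((t : ℂ) ^ (n + 1) * Complex.exp (-z * t))) t := by
      intro t
      have h := ((hasDerivAt_pow (n + 1) (t : ℂ)).comp_ofReal).mul (hexp t)
      refine h.congr_deriv ?_
      push_cast
      simp
      ring
    have h := integral_Ioi_of_hasDerivAt_of_tendsto' (a := 0) (fun t _ ↦ hd t)
      (((integrableOn_pow_mul_cexp_neg_mul n hz).const_mul _).add
        ((integrableOn_pow_mul_cexp_neg_mul (n + 1) hz).const_mul _)) (hlim (n + 1))
    rw [integral_add ((integrableOn_pow_mul_cexp_neg_mul n hz).const_mul _)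
        ((integrableOn_pow_mul_cexp_neg_mul (n + 1) hz).const_mul _), integral_const_mul,
      integral_const_mul, ih] at h
    simp only [Complex.ofReal_zero, ne_eq, Nat.succ_ne_zero, not_false_eq_true, zero_pow,
      zero_mul, sub_zero] at h
    rw [Nat.factorial_succ, eq_div_iff (pow_ne_zero _ hz0)]
    push_cast
    have h2 : (n.factorial : ℂ) / z ^ (n + 1) * z ^ (n + 1) = n.factorial :=
      div_mul_cancel₀ _ (pow_ne_zero _ hz0)
    rw [pow_succ z (n + 1)]
    linear_combination (-z ^ (n + 1)) * h + (n + 1) * h2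

/-- A principal part of order at most `N` at the origin is the Laplace transform of a polynomial of
degree less than `N`. -/
lemma exists_laplace_eq_principal_part (N : ℕ) (c : ℕ → ℂ) :
    ∃ p : ℝ → ℂ, Continuous p ∧ Tendsto (fun t : ℝ ↦ p t / (t : ℂ) ^ N) atTop (𝓝 0) ∧
      ∀ z : ℂ, 0 < z.re →
        IntegrableOn (fun t : ℝ ↦ p t * Complex.exp (-z * t)) (Set.Ioi 0) ∧
        ∫ t in Set.Ioi (0 : ℝ), p t * Complex.exp (-z * t) =
          (∑ j ∈ Finset.range N, c j * z ^ j) / z ^ N := by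
  refine ⟨fun t ↦ ∑ j ∈ Finset.range N,
    c j / (N - 1 - j).factorial * (t : ℂ) ^ (N - 1 - j), by fun_prop, ?_, fun z hz ↦ ?_⟩
  · simp only [Finset.sum_div]
    rw [← Finset.sum_const_zero (s := Finset.range N)]
    refine tendsto_finsetSum _ fun j hj ↦ ?_
    have hj := Finset.mem_range.1 hj
    have h0 : Tendsto (fun t : ℝ ↦ ((t ^ (j + 1))⁻¹ : ℝ)) atTop (𝓝 0) :=
      (tendsto_pow_atTop (Nat.succ_ne_zero j)).inv_tendsto_atTop
    have h := ((Complex.continuous_ofReal.tendsto 0).comp h0).const_mul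
      (c j / (N - 1 - j).factorial)
    rw [Complex.ofReal_zero, mul_zero] at h
    refine h.congr' ?_
    filter_upwards [eventually_gt_atTop 0] with t ht
    have ht' : (t : ℂ) ≠ 0 := by exact_mod_cast ht.ne'
    have hN : N = (N - 1 - j) + (j + 1) := by omega
    rw [mul_div_assoc]
    congr 1
    rw [eq_div_iff (pow_ne_zero _ ht')]
    nth_rw 1 [hN]
    rw [pow_add]
    simp only [Function.comp_apply]
    push_cast
    field_simp
  · have hz0 : z ≠ 0 := by rintro rfl; simp at hz
    have hi : ∀ j ∈ Finset.range N, IntegrableOn (fun t : ℝ ↦ c j / (N - 1 - j).factorial *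
        ((t : ℂ) ^ (N - 1 - j) * Complex.exp (-z * t))) (Set.Ioi 0) :=
      fun j _ ↦ (integrableOn_pow_mul_cexp_neg_mul _ hz).const_mul _
    simp only [Finset.sum_mul, mul_assoc]
    refine ⟨integrable_finsetSum _ hi, ?_⟩
    rw [integral_finsetSum _ hi, Finset.sum_div]
    refine Finset.sum_congr rfl fun j hj ↦ ?_
    have hj := Finset.mem_range.1 hj
    rw [integral_const_mul, integral_pow_mul_cexp_neg_mul _ hz]
    have hN : z ^ N = z ^ (N - 1 - j + 1) * z ^ j := by rw [← pow_add]; congr 1; omega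
    have hf : ((N - 1 - j).factorial : ℂ) ≠ 0 := by exact_mod_cast Nat.factorial_ne_zero _
    rw [hN]
    field_simp

lemma tendsto_pow_mul_integral_Ioc (N : ℕ) {ε : ℝ} (hε : 0 < ε) :
    Tendsto (fun t : ℝ ↦ t ^ (N + 1) * ∫ u in Set.Ioc (0 : ℝ) ε, u ^ N * Real.exp (-t * u))
      atTop (𝓝 N.factorial) := by
  have hfun : Set.EqOn (fun x : ℝ ↦ Real.exp (-x) * x ^ ((N + 1 : ℝ) - 1))
      (fun x ↦ x ^ N * Real.exp (-x)) (Set.Ioi 0) := by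
    intro x _
    simp [mul_comm]
  have hint : IntegrableOn (fun x : ℝ ↦ x ^ N * Real.exp (-x)) (Set.Ioi 0) :=
    (Real.GammaIntegral_convergent (s := N + 1) (by positivity)).congr_fun hfun measurableSet_Ioi
  have hval : ∫ x in Set.Ioi (0 : ℝ), x ^ N * Real.exp (-x) = N.factorial := by
    rw [← Real.Gamma_nat_eq_factorial, Real.Gamma_eq_integral (by positivity)]
    exact (setIntegral_congr_fun measurableSet_Ioi hfun).symm
  have h := intervalIntegral_tendsto_integral_Ioi 0 hint (tendsto_id.atTop_mul_const hε)
  rw [hval] at h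
  refine h.congr' ?_
  filter_upwards [eventually_gt_atTop 0] with t ht
  have h1 := intervalIntegral.integral_comp_mul_left (a := 0) (b := ε)
    (fun x ↦ x ^ N * Real.exp (-x)) ht.ne'
  rw [mul_zero, smul_eq_mul, eq_inv_mul_iff_mul_eq₀ ht.ne'] at h1
  rw [id_eq, ← h1, ← intervalIntegral.integral_of_le hε.le, ← intervalIntegral.integral_const_mul,
    ← intervalIntegral.integral_const_mul]
  congr 1
  ext u
  rw [neg_mul]
  ring

lemma tendsto_div_pow_of_tendsto_mul_integral {b : ℝ → ℝ} {N : ℕ} {ε : ℝ} (hε : 0 < ε)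
    (hb : Tendsto
      (fun t : ℝ ↦ t * b t * ∫ u in Set.Ioc (0 : ℝ) ε, u ^ N * Real.exp (-t * u)) atTop (𝓝 1)) :
    Tendsto (fun t ↦ b t / t ^ N) atTop (𝓝 (1 / N.factorial)) := by
  have hN : (N.factorial : ℝ) ≠ 0 := by exact_mod_cast N.factorial_ne_zero
  have h := tendsto_pow_mul_integral_Ioc N hε
  refine (hb.div h hN).congr' ?_
  filter_upwards [h.eventually_ne hN, eventually_gt_atTop 0] with t ht ht0
  have hJ := right_ne_zero_of_mul ht
  simp only [Pi.div_apply]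
  generalize (∫ u in Set.Ioc (0 : ℝ) ε, u ^ N * Real.exp (-t * u)) = J at hJ ⊢
  field_simp
  ring

lemma exists_norm_le_mul_one_add_pow {B : ℝ → ℂ} {N : ℕ} {L : ℂ}
    (hloc : ∀ T : ℝ, 0 < T → ∃ M : ℝ, ∀ t ∈ Set.Icc (0 : ℝ) T, ‖B t‖ ≤ M)
    (hB : Tendsto (fun t : ℝ ↦ B t / (t : ℂ) ^ N) atTop (𝓝 L)) :
    ∃ C : ℝ, ∀ t > 0, ‖B t‖ ≤ C * (1 + t) ^ N := by
  obtain ⟨T, hT⟩ := eventually_atTop.1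
    ((hB.norm.eventually_lt_const (lt_add_one ‖L‖)).and (eventually_gt_atTop 0))
  have hT0 : 0 < T := (hT T le_rfl).2
  obtain ⟨M, hM⟩ := hloc T hT0
  have hM0 : 0 ≤ M := (norm_nonneg _).trans (hM T ⟨hT0.le, le_rfl⟩)
  refine ⟨‖L‖ + 1 + M, fun t ht ↦ ?_⟩
  rw [add_mul]
  rcases le_total t T with h | h
  · refine le_add_of_nonneg_of_le (by positivity) ((hM t ⟨ht.le, h⟩).trans ?_)
    exact le_mul_of_one_le_right hM0 (one_le_pow₀ (by linarith))
  · refine le_add_of_le_of_nonneg ?_ (by positivity)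
    have h1 := (hT t h).1
    rw [norm_div, norm_pow, Complex.norm_real, Real.norm_of_nonneg ht.le,
      div_lt_iff₀ (by positivity)] at h1
    refine h1.le.trans ?_
    gcongr
    linarith

lemma exists_sum_range_eq_eval_add {g : Polynomial ℂ} {N : ℕ} (hg1 : N + 1 = 1 → g = 0)
    (hg2 : 2 ≤ N + 1 → g.degree ≤ (N + 1 - 2 : ℕ)) (α : ℂ) :
    ∃ c : ℕ → ℂ, ∀ z, g.eval (α + z) = ∑ j ∈ Finset.range N, c j * z ^ j := by
  rcases N with _ | n
  · exact ⟨0, fun z ↦ by simp [hg1 rfl]⟩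
  · refine ⟨(g.comp (Polynomial.X + Polynomial.C α)).coeff, fun z ↦ ?_⟩
    have hd : (g.comp (Polynomial.X + Polynomial.C α)).natDegree < n + 1 := by
      have h := Polynomial.natDegree_le_of_degree_le (hg2 (by omega))
      rw [Polynomial.natDegree_comp, Polynomial.natDegree_X_add_C]
      omega
    rw [← Polynomial.eval_eq_sum_range' hd, Polynomial.eval_comp]
    simp [add_comm]

/-- Delange-type Tauberian theorem. -/
theorem delange_tauberian
    (b : ℝ → ℝ) (hbmeas : Measurable b)
    (hbloc : ∀ T : ℝ, 0 < T → ∃ M : ℝ, ∀ t ∈ Set.Icc (0 : ℝ) T, |b t| ≤ M)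
    (hGconv : ∀ s : ℂ, 0 < s.re →
      IntegrableOn (fun t : ℝ => (b t : ℂ) * Complex.exp (-s * t)) (Set.Ioi 0))
    (m : ℕ) (hm : 1 ≤ m) (ε₀ : ℝ) (hε₀ : 0 < ε₀)
    (hblim : Filter.Tendsto
      (fun t : ℝ => t * b t * ∫ u in Set.Ioc (0 : ℝ) ε₀, u ^ (m - 1) * Real.exp (-t * u))
      Filter.atTop (nhds 1))
    (a : ℝ → ℝ) (hamono : MonotoneOn a (Set.Ici 0))
    (α : ℝ) (hα : 0 < α)
    (hfconv : ∀ s : ℂ, α < s.re →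
      IntegrableOn (fun t : ℝ => (a t : ℂ) * Complex.exp (-s * t)) (Set.Ioi 0))
    (c₀ : ℝ) (hc₀ : 0 < c₀) (g : Polynomial ℂ)
    (hg1 : m = 1 → g = 0) (hg2 : 2 ≤ m → g.degree ≤ (m - 2 : ℕ))
    (h : ℂ → ℂ) (hhc : ContinuousOn h {s : ℂ | α ≤ s.re})
    (hhd : DifferentiableOn ℂ h {s : ℂ | α < s.re})
    (heq : ∀ s : ℂ, α < s.re →
      (∫ t in Set.Ioi (0 : ℝ), (a t : ℂ) * Complex.exp (-s * t)) -
          (c₀ : ℂ) * ∫ t in Set.Ioi (0 : ℝ), (b t : ℂ) * Complex.exp (-(s - α) * t) =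
        g.eval s / (s - α) ^ (m - 1) + h s) :
    Filter.Tendsto (fun t : ℝ => a t / (Real.exp (α * t) * b t))
      Filter.atTop (nhds c₀) := by
  obtain ⟨N, rfl⟩ := Nat.exists_eq_add_of_le' hm
  rw [Nat.add_sub_cancel] at hblim
  simp only [Nat.add_sub_cancel] at heq
  have hb := tendsto_div_pow_of_tendsto_mul_integral hε₀ hblim
  obtain ⟨c, hc⟩ := exists_sum_range_eq_eval_add hg1 hg2 α
  obtain ⟨p, hpc, hp0, hp⟩ := exists_laplace_eq_principal_part N c
  let A : ℝ → ℝ := fun t ↦ (a t - a 0) * Real.exp (-α * t)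
  let B : ℝ → ℂ := fun t ↦ c₀ * b t + p t - a 0 * Complex.exp (-α * t)
  have hexp : Tendsto (fun t : ℝ ↦ a 0 * Real.exp (-α * t) / t ^ N) atTop (𝓝 0) := by
    have h1 := (isLittleO_pow_exp_pos_mul_atTop 0 hα).tendsto_div_nhds_zero.const_mul (a 0)
    rw [mul_zero] at h1
    refine squeeze_zero_norm' ?_ (by simpa using h1.norm)
    filter_upwards [eventually_ge_atTop 1] with t ht
    have h2 : 1 ≤ |t ^ N| := (one_le_pow₀ ht).trans (le_abs_self _)
    rw [Real.norm_eq_abs, abs_div, neg_mul, Real.exp_neg]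
    simpa [abs_mul] using div_le_self (abs_nonneg (a 0 * (Real.exp (α * t))⁻¹)) h2
  have hBL : Tendsto (fun t : ℝ ↦ B t / (t : ℂ) ^ N) atTop
      (𝓝 ((c₀ / N.factorial : ℝ) : ℂ)) := by
    have h1 := (Complex.continuous_ofReal.tendsto _).comp ((hb.const_mul c₀).sub hexp)
    have h2 := h1.add hp0
    rw [add_zero, sub_zero, mul_one_div] at h2
    refine h2.congr fun t ↦ ?_
    simp only [Function.comp_apply, B]
    push_cast
    ring
  have hBloc : ∀ T : ℝ, 0 < T → ∃ M : ℝ, ∀ t ∈ Set.Icc (0 : ℝ) T, ‖B t‖ ≤ M := by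
    intro T hT
    obtain ⟨M, hM⟩ := hbloc T hT
    obtain ⟨M', hM'⟩ := isCompact_Icc.exists_bound_of_continuousOn (s := Set.Icc 0 T)
      (f := fun t : ℝ ↦ p t - a 0 * Complex.exp (-α * t)) (by fun_prop)
    refine ⟨|c₀| * M + M', fun t ht ↦ ?_⟩
    simp only [B, add_sub_assoc]
    refine (norm_add_le _ _).trans (add_le_add ?_ (hM' t ht))
    rw [norm_mul, Complex.norm_real, Complex.norm_real]
    exact mul_le_mul_of_nonneg_left (hM t ht) (abs_nonneg _)
  obtain ⟨C, hC⟩ := exists_norm_le_mul_one_add_pow hBloc hBL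
  have hBm : Measurable B := by
    have := hpc.measurable
    fun_prop
  have hre : ∀ z : ℂ, 0 < z.re → α < (α + z).re := fun z hz ↦ by simpa using hz
  have hdiff : ∀ z : ℂ, ∀ t : ℝ, (A t - B t) * Complex.exp (-z * t) =
      a t * Complex.exp (-(α + z) * t) - c₀ * (b t * Complex.exp (-z * t)) -
        p t * Complex.exp (-z * t) := by
    intro z t
    have h1 : Complex.exp (-(α + z) * t) = Complex.exp (-α * t) * Complex.exp (-z * t) := by
      rw [← Complex.exp_add]
      ring_nf
    simp only [A, B, h1]
    push_cast
    ring
  have hA0 : ∀ t, 0 ≤ t → 0 ≤ A t := fun t ht ↦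
    mul_nonneg (sub_nonneg.2 (hamono Set.self_mem_Ici ht ht)) (Real.exp_pos _).le
  have hmono : ∀ s t, 0 ≤ s → s ≤ t → A s ≤ A t * Real.exp (α * (t - s)) := by
    intro s t hs hst
    have h1 : A t * Real.exp (α * (t - s)) = (a t - a 0) * Real.exp (-α * s) := by
      simp only [A]
      rw [mul_assoc, ← Real.exp_add]
      ring_nf
    have h2 := hamono hs (hs.trans hst) hst
    rw [h1]
    simp only [A]
    gcongr
  have hAlim : Tendsto (fun t ↦ A t / t ^ N) atTop (𝓝 (c₀ / N.factorial)) := by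
    refine tendsto_div_pow_of_smoothed hα hA0 hmono fun δ hδ ↦ ?_
    obtain ⟨K, k, hK, hKs, hk, hk0, hKk, hk1, hkN, htail⟩ :=
      exists_concentrated_bandlimited_kernel N hδ
    refine ⟨k, hk0, hk1, hkN, htail, ?_⟩
    refine tendsto_smoothed_of_laplace_boundary (H := fun z ↦ h (α + z))
      (fun t ht ↦ hA0 t ht.le) hBm.aestronglyMeasurable hC hBL (fun z hz ↦ ?_) (fun z hz ↦ ?_)
      ?_ hK hKs hk hk0 hKk hk1 hkN
    · simp only [hdiff]
      exact ((hfconv _ (hre z hz)).sub ((hGconv z hz).const_mul _)).sub (hp z hz).1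
    · have hi := (hGconv z hz).const_mul (c₀ : ℂ)
      have h1 := heq _ (hre z hz)
      rw [add_sub_cancel_left, hc] at h1
      simp only [hdiff]
      have hi' : IntegrableOn (fun t : ℝ ↦ (a t : ℂ) * Complex.exp (-(α + z) * t) -
          c₀ * (b t * Complex.exp (-z * t))) (Set.Ioi 0) := (hfconv _ (hre z hz)).sub hi
      rw [integral_sub hi' (hp z hz).1, integral_sub (hfconv _ (hre z hz)) hi,
        integral_const_mul, h1, (hp z hz).2]
      ring
    · exact hhc.comp (by fun_prop) fun z hz ↦ by simpa using hz
  have hN : (1 / N.factorial : ℝ) ≠ 0 := by positivity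
  have hfin := (hAlim.add hexp).div hb hN
  have hval : (c₀ / N.factorial + 0) / (1 / N.factorial : ℝ) = c₀ := by
    have : (N.factorial : ℝ) ≠ 0 := by positivity
    field_simp
    simp
  rw [hval] at hfin
  refine hfin.congr' ?_
  filter_upwards [eventually_gt_atTop 0] with t ht
  simp only [A, Pi.div_apply]
  rw [← add_div, div_div_div_cancel_right₀ (by positivity), neg_mul, Real.exp_neg]
  field_simp
  ring
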